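/- arXiv:1610.09544 — 2 statements merged into one kernel-verified Lean document; each statement's English description precedes it below -/
import Mathlib

section
/- For each n ≥ 1, the component L_n = span{X(r) : |r| = n+2} of the polynomial Hamiltonian Lie algebra, viewed as a module over L₀ ≅ 𝔰𝔭_N(ℂ) via the adjoint action, is an irreducible 𝔰𝔭_N-module. -/
open Sum MvPolynomial

/-- The algebra `ℂ[x₁,…,x_N]`, `N = 2m`, with coordinates `1,…,m` indexed by `inl i`
and `m+1,…,2m` indexed by `inr i`. -/
abbrev PolyA (m : ℕ) := MvPolynomial (Fin m ⊕ Fin m) ℂ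

/-- The monomial `x^a`. -/
noncomputable def xpow {m : ℕ} (a : Fin m ⊕ Fin m →₀ ℕ) : PolyA m := monomial a 1

/-- `X(r) = Σ_{i=1}^m (r_{m+i} x^{r−e_{m+i}} ∂/∂xᵢ − rᵢ x^{r−eᵢ} ∂/∂x_{m+i})`. -/
noncomputable def XH {m : ℕ} (r : Fin m ⊕ Fin m →₀ ℕ) : Derivation ℂ (PolyA m) (PolyA m) :=
  ∑ i : Fin m,
    ((r (inr i) : ℂ) • (xpow (r - Finsupp.single (inr i) 1) • pderiv (inl i))
      - (r (inl i) : ℂ) • (xpow (r - Finsupp.single (inl i) 1) • pderiv (inr i)))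

/-- `L_n = span{X(r) : |r| = n+2}`. -/
noncomputable def Lcomp (m : ℕ) (n : ℕ) : Submodule ℂ (Derivation ℂ (PolyA m) (PolyA m)) :=
  Submodule.span ℂ {d | ∃ r : Fin m ⊕ Fin m →₀ ℕ, (∑ j, r j) = n + 2 ∧ d = XH r}

/-- The Hamiltonian derivation of a polynomial. -/
noncomputable def hamD (m : ℕ) : PolyA m →ₗ[ℂ] Derivation ℂ (PolyA m) (PolyA m) where
  toFun f := ∑ i : Fin m, (pderiv (inr i) f • pderiv (inl i) - pderiv (inl i) f • pderiv (inr i))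
  map_add' f g := by
    simp only [map_add, add_smul, ← Finset.sum_add_distrib]
    exact Finset.sum_congr rfl fun i _ => by abel
  map_smul' c f := by
    simp only [Derivation.map_smul, smul_assoc, Finset.smul_sum, smul_sub, RingHom.id_apply]

theorem hamD_apply {m : ℕ} (f g : PolyA m) : hamD m f g = ∑ i : Fin m,
    (pderiv (inr i) f * pderiv (inl i) g - pderiv (inl i) f * pderiv (inr i) g) := by
  have h := map_sum (Derivation.coeFnAddMonoidHom (R := ℂ) (A := PolyA m) (M := PolyA m))
    (fun i : Fin m => pderiv (inr i) f • pderiv (inl i) - pderiv (inl i) f • pderiv (inr i))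
    Finset.univ
  have h2 := congrFun h g
  rw [Finset.sum_apply] at h2
  exact h2

theorem hamD_anti {m : ℕ} (f g : PolyA m) : hamD m f g = - hamD m g f := by
  rw [hamD_apply, hamD_apply, ← Finset.sum_neg_distrib]
  exact Finset.sum_congr rfl fun i _ => by ring

theorem hamD_inl {m : ℕ} (f : PolyA m) (k : Fin m) : hamD m f (X (inl k)) = pderiv (inr k) f := by
  rw [hamD_apply, Finset.sum_eq_single k]
  · simp
  · intro b _ hb
    rw [pderiv_X_of_ne (by simpa using hb.symm), pderiv_X_of_ne (by simp)]; simp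
  · simp

theorem hamD_inr {m : ℕ} (f : PolyA m) (k : Fin m) : hamD m f (X (inr k)) = - pderiv (inl k) f := by
  rw [hamD_apply, Finset.sum_eq_single k]
  · simp
  · intro b _ hb
    rw [pderiv_X_of_ne (by simp), pderiv_X_of_ne (by simpa using hb.symm)]; simp
  · simp

theorem hamD_monomial {m : ℕ} (r : Fin m ⊕ Fin m →₀ ℕ) : hamD m (monomial r 1) = XH r := by
  have key : ∀ j, pderiv j (monomial r (1:ℂ)) = (r j : ℂ) • xpow (r - Finsupp.single j 1) := by
    intro j
    simp [pderiv_monomial, xpow, smul_monomial]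
  simp only [hamD, XH, LinearMap.coe_mk, AddHom.coe_mk, key, smul_assoc]

theorem pd_comm {σ : Type*} (i j : σ) (f : MvPolynomial σ ℂ) :
    pderiv i (pderiv j f) = pderiv j (pderiv i f) := by
  have : ⁅(pderiv i : Derivation ℂ (MvPolynomial σ ℂ) (MvPolynomial σ ℂ)),
      (pderiv j : Derivation ℂ (MvPolynomial σ ℂ) (MvPolynomial σ ℂ))⁆ = 0 := by
    classical
    apply MvPolynomial.derivation_ext
    intro k
    simp [Derivation.commutator_apply, pderiv_X, Pi.single_apply, apply_ite]
  have h := congrArg (fun D => D f) this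
  simpa [Derivation.commutator_apply, sub_eq_zero] using h

theorem pd_hamD {m : ℕ} (k : Fin m ⊕ Fin m) (f g : PolyA m) :
    pderiv k (hamD m f g) = hamD m (pderiv k f) g + hamD m f (pderiv k g) := by
  simp only [hamD_apply, map_sum, ← Finset.sum_add_distrib]
  refine Finset.sum_congr rfl fun i _ => ?_
  simp only [map_sub, pderiv_mul]
  rw [pd_comm k (inl i) f, pd_comm k (inr i) f, pd_comm k (inl i) g, pd_comm k (inr i) g]
  ring

theorem hamD_lie {m : ℕ} (f g : PolyA m) : ⁅hamD m f, hamD m g⁆ = hamD m (hamD m f g) := by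
  apply MvPolynomial.derivation_ext
  intro k
  rw [Derivation.commutator_apply]
  cases k with
  | inl k =>
    simp only [hamD_inl, pd_hamD]
    rw [hamD_anti g]; ring
  | inr k =>
    simp only [hamD_inr, pd_hamD, map_neg]
    rw [hamD_anti g]; ring

theorem hamD_quad {m : ℕ} (a b : Fin m ⊕ Fin m) (g : PolyA m) :
    hamD m (X a * X b) g = - (X a * hamD m g (X b) + X b * hamD m g (X a)) := by
  rw [hamD_anti, Derivation.leibniz]; simp

theorem down_lemma {σ : Type*} (w : σ → ℕ) (E : σ → σ → Prop) (hE : ∀ a b, E a b → w a < w b)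
    (S : MvPolynomial σ ℂ → Prop) (hS : ∀ a b, E a b → ∀ f, S f → S (X a * pderiv b f)) :
    ∀ (k : ℕ) (f : MvPolynomial σ ℂ), S f → f ≠ 0 →
      (∀ r, coeff r f ≠ 0 → Finsupp.weight w r < k) →
      ∃ g, S g ∧ g ≠ 0 ∧ ∀ a b, E a b → pderiv b g = 0 := by
  intro k
  induction k with
  | zero =>
    intro f _ h0 hb
    obtain ⟨d, hd⟩ := exists_coeff_ne_zero h0
    exact absurd (hb d hd) (by simp)
  | succ k ih =>
    intro f hf h0 hb
    by_cases h : ∀ a b, E a b → pderiv b f = 0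
    · exact ⟨f, hf, h0, h⟩
    push Not at h
    obtain ⟨a, b, hab, hne⟩ := h
    refine ih _ (hS a b hab f hf) (mul_ne_zero (X_ne_zero a) hne) ?_
    intro r hr
    classical
    rw [coeff_X_mul'] at hr
    split_ifs at hr with har
    · rw [coeff_pderiv] at hr
      have h1 : coeff (r - Finsupp.single a 1 + Finsupp.single b 1) f ≠ 0 := by
        intro h2; apply hr; simp [h2]
      have h2 := hb _ h1
      have h3 : Finsupp.single a 1 ≤ r := by
        rw [Finsupp.single_le_iff]
        exact Nat.one_le_iff_ne_zero.2 (Finsupp.mem_support_iff.1 har)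
      have h4 : r = r - Finsupp.single a 1 + Finsupp.single a 1 := (tsub_add_cancel_of_le h3).symm
      rw [h4]
      have := hE a b hab
      simp only [map_add, Finsupp.weight_single, smul_eq_mul, one_mul] at h2 ⊢
      omega
    · exact absurd rfl hr

theorem down_lemma2 {σ : Type*} (w : σ → ℕ) (E : σ → σ → Prop) (hE : ∀ a b, E a b → w a < w b)
    (S : MvPolynomial σ ℂ → Prop) (hS : ∀ a b, E a b → ∀ f, S f → S (X a * pderiv b f))
    (f : MvPolynomial σ ℂ) (hf : S f) (h0 : f ≠ 0) :
      ∃ g, S g ∧ g ≠ 0 ∧ ∀ a b, E a b → pderiv b g = 0 := by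
  refine down_lemma w E hE S hS (f.support.sup (Finsupp.weight w) + 1) f hf h0 ?_
  intro r hr
  exact Nat.lt_succ_of_le (Finset.le_sup (f := fun r => Finsupp.weight w r) (mem_support_iff.2 hr))

theorem up_lemma {σ : Type*} (w : σ → ℕ) (E : σ → σ → Prop) (hE : ∀ a b, E a b → w a < w b)
    (S : (σ →₀ ℕ) → Prop) (hbase : ∀ r, (∀ a b, E a b → r b = 0) → S r)
    (hS : ∀ a b, E a b → ∀ r, S (r + Finsupp.single a 1) → S (r + Finsupp.single b 1)) :
    ∀ (k : ℕ) (r : σ →₀ ℕ), Finsupp.weight w r < k → S r := by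
  intro k
  induction k with
  | zero => intro r h; simp at h
  | succ k ih =>
    intro r hr
    by_cases h : ∀ a b, E a b → r b = 0
    · exact hbase r h
    push Not at h
    obtain ⟨a, b, hab, hne⟩ := h
    have h3 : Finsupp.single b 1 ≤ r := by
      classical
      rw [Finsupp.single_le_iff]
      exact Nat.one_le_iff_ne_zero.2 hne
    have h4 : r = r - Finsupp.single b 1 + Finsupp.single b 1 := (tsub_add_cancel_of_le h3).symm
    rw [h4] at hr ⊢
    apply hS a b hab
    apply ih
    have := hE a b hab
    simp only [map_add, Finsupp.weight_single, smul_eq_mul, one_mul] at hr ⊢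
    omega

theorem pd_zero_coeff {σ : Type*} {b : σ} {f : MvPolynomial σ ℂ} (h : pderiv b f = 0)
    {r : σ →₀ ℕ} (hr : coeff r f ≠ 0) : r b = 0 := by
  by_contra hne
  have h3 : Finsupp.single b 1 ≤ r := by
    classical
    rw [Finsupp.single_le_iff]
    exact Nat.one_le_iff_ne_zero.2 hne
  have h1 := coeff_pderiv (i := b) f (r - Finsupp.single b 1)
  rw [h, coeff_zero, tsub_add_cancel_of_le h3] at h1
  rcases mul_eq_zero.1 h1.symm with h2 | h2
  · exact hr h2
  · exact Nat.cast_add_one_ne_zero _ h2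

theorem pd_mon {σ : Type*} (a b : σ) (r : σ →₀ ℕ) :
    X b * pderiv a (monomial (r + Finsupp.single a 1) (1:ℂ)) =
      ((r a + 1 : ℕ) : ℂ) • monomial (r + Finsupp.single b 1) 1 := by
  rw [pderiv_monomial, X, monomial_mul, smul_monomial]
  simp [add_comm]

theorem homog_step {σ : Type*} {d : ℕ} (hd : 1 ≤ d) (a b : σ) {f : MvPolynomial σ ℂ}
    (hf : f.IsHomogeneous d) : (X a * pderiv b f).IsHomogeneous d := by
  have := (isHomogeneous_X ℂ a).mul (hf.pderiv (i := b))
  rwa [show 1 + (d - 1) = d by omega] at this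

theorem Lcomp_eq (m n : ℕ) :
    Lcomp m n = (homogeneousSubmodule (Fin m ⊕ Fin m) ℂ (n+2)).map (hamD m) := by
  apply le_antisymm
  · rw [Lcomp, Submodule.span_le]
    rintro d ⟨r, hr, rfl⟩
    refine ⟨monomial r 1, ?_, hamD_monomial r⟩
    exact isHomogeneous_monomial _ (by rw [Finsupp.degree_eq_sum]; exact hr)
  · rintro _ ⟨f, hf, rfl⟩
    rw [f.as_sum, map_sum]
    refine Submodule.sum_mem _ fun r hr => ?_
    have : monomial r (coeff r f) = coeff r f • monomial r (1:ℂ) := by simp [smul_monomial]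
    rw [this, map_smul, hamD_monomial]
    refine Submodule.smul_mem _ _ (Submodule.subset_span ⟨r, ?_, rfl⟩)
    rw [← Finsupp.degree_eq_sum]
    by_contra hne
    exact (mem_support_iff.1 hr) (IsHomogeneous.coeff_eq_zero hf hne)

theorem main_irr {m : ℕ} (i₀ : Fin m) (d : ℕ) (hd : 1 ≤ d) (U : Submodule ℂ (PolyA m))
    (hU : ∀ a b, ∀ f ∈ U, hamD m (X a * X b) f ∈ U)
    (f : PolyA m) (hfU : f ∈ U) (hf0 : f ≠ 0) (hfd : f.IsHomogeneous d) :
    ∀ r : Fin m ⊕ Fin m →₀ ℕ, r.degree = d → monomial r 1 ∈ U := by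
  have hxy : ∀ i, ∀ f ∈ U, X (inl i) * pderiv (inr i) f ∈ U := by
    intro i f hf
    have h := U.smul_mem (-(1/2:ℂ)) (hU (inl i) (inl i) f hf)
    rw [hamD_quad, hamD_inl] at h
    convert h using 1
    rw [← two_mul, ← map_ofNat (C : ℂ →+* PolyA m), ← smul_eq_C_mul, ← smul_neg, smul_smul]
    simp
  have hyx : ∀ i, ∀ f ∈ U, X (inr i) * pderiv (inl i) f ∈ U := by
    intro i f hf
    have h := U.smul_mem (1/2:ℂ) (hU (inr i) (inr i) f hf)
    rw [hamD_quad, hamD_inr] at h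
    convert h using 1
    rw [← two_mul, ← map_ofNat (C : ℂ →+* PolyA m), ← smul_eq_C_mul, ← smul_neg, smul_smul]
    simp
  have hxx : ∀ i j, ∀ f ∈ U, pderiv (inr i) f = 0 → X (inl i) * pderiv (inl j) f ∈ U := by
    intro i j f hf h0
    have h := hU (inl i) (inr j) f hf
    rw [hamD_quad, hamD_inr, hamD_inl, h0] at h
    simpa using h
  -- stage 1
  obtain ⟨g, ⟨hgU, hgd⟩, hg0, hg⟩ := down_lemma2 (σ := Fin m ⊕ Fin m)
    (Sum.elim (fun _ => 0) (fun _ => 1)) (fun a b => ∃ i, a = inl i ∧ b = inr i)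
    (by rintro _ _ ⟨i, rfl, rfl⟩; simp) (fun f => f ∈ U ∧ f.IsHomogeneous d)
    (by rintro _ _ ⟨i, rfl, rfl⟩ f ⟨h1, h2⟩; exact ⟨hxy i f h1, homog_step hd _ _ h2⟩)
    f ⟨hfU, hfd⟩ hf0
  -- stage 2
  obtain ⟨p, ⟨hpU, hpd, hpy⟩, hp0, hp⟩ := down_lemma2 (σ := Fin m ⊕ Fin m)
    (Sum.elim (fun i => if i = i₀ then 0 else 1) (fun _ => 0))
    (fun a b => ∃ j, j ≠ i₀ ∧ a = inl i₀ ∧ b = inl j)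
    (by rintro _ _ ⟨j, hj, rfl, rfl⟩; simp [hj])
    (fun f => f ∈ U ∧ f.IsHomogeneous d ∧ ∀ i, pderiv (inr i) f = 0)
    (by
      rintro _ _ ⟨j, hj, rfl, rfl⟩ f ⟨h1, h2, h3⟩
      refine ⟨hxx _ _ f h1 (h3 _), homog_step hd _ _ h2, fun i => ?_⟩
      rw [pderiv_mul, pd_comm, h3, pderiv_X_of_ne (by simp)]; simp)
    g ⟨hgU, hgd, fun i => hg _ _ ⟨i, rfl, rfl⟩⟩ hg0
  have hsupp : ∀ r : Fin m ⊕ Fin m →₀ ℕ, r.degree = d → (∀ i, r (inr i) = 0) → (∀ j, j ≠ i₀ → r (inl j) = 0) →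
      r = Finsupp.single (inl i₀) d := by
    intro r hr h1 h2
    have h3 : r = Finsupp.single (inl i₀) (r (inl i₀)) := by
      ext j
      rcases j with j | j
      · by_cases hj : j = i₀
        · subst hj; simp
        · rw [h2 j hj, Finsupp.single_eq_of_ne (by simpa using hj)]
      · rw [h1 j, Finsupp.single_eq_of_ne (by simp)]
    rw [h3, Finsupp.degree_single] at hr
    rw [← hr]; exact h3
  have hpc : ∀ r, coeff r p ≠ 0 → r = Finsupp.single (inl i₀) d := by
    intro r hr
    refine hsupp r ?_ (fun i => pd_zero_coeff (hpy i) hr)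
      (fun j hj => pd_zero_coeff (hp _ _ ⟨j, hj, rfl, rfl⟩) hr)
    by_contra hne
    exact hr (hpd.coeff_eq_zero hne)
  have htop : monomial (Finsupp.single (inl i₀) d) 1 ∈ U := by
    obtain ⟨r, hr⟩ := exists_coeff_ne_zero hp0
    have hr' := hpc r hr
    rw [hr'] at hr
    have hpe : p = monomial (Finsupp.single (inl i₀) d) (coeff (Finsupp.single (inl i₀) d) p) := by
      classical
      ext s
      rw [coeff_monomial]
      split_ifs with hs
      · rw [hs]
      · by_contra hne
        exact hs (hpc s hne).symm
    have h := U.smul_mem (coeff (Finsupp.single (inl i₀) d) p)⁻¹ hpU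
    rw [hpe, smul_monomial, coeff_monomial, if_pos rfl, smul_eq_mul, inv_mul_cancel₀ hr] at h
    exact h
  have hcancel : ∀ (k : ℕ) (q : PolyA m), ((k + 1 : ℕ) : ℂ) • q ∈ U → q ∈ U := by
    intro k q h
    exact (U.smul_mem_iff (Nat.cast_ne_zero.2 k.succ_ne_zero)).1 h
  -- upward
  have hx : ∀ r : Fin m ⊕ Fin m →₀ ℕ, r.degree = d → (∀ i, r (inr i) = 0) → monomial r 1 ∈ U := by
    intro r
    refine up_lemma (σ := Fin m ⊕ Fin m)
      (Sum.elim (fun i => if i = i₀ then 0 else 1) (fun _ => 0))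
      (fun a b => ∃ j, j ≠ i₀ ∧ a = inl i₀ ∧ b = inl j)
      (by rintro _ _ ⟨j, hj, rfl, rfl⟩; simp [hj])
      (fun r => r.degree = d → (∀ i, r (inr i) = 0) → monomial r 1 ∈ U) ?_ ?_ _ r
      (Nat.lt_succ_self _)
    · intro r h1 h2 h3
      rw [hsupp r h2 h3 (fun j hj => h1 _ _ ⟨j, hj, rfl, rfl⟩)]
      exact htop
    · rintro _ _ ⟨j, hj, rfl, rfl⟩ r h1 h2 h3
      have h4 : monomial (r + Finsupp.single (inl i₀) 1) 1 ∈ U := by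
        apply h1
        · simpa using h2
        · simpa using h3
      have h5 := hxx j i₀ _ h4 (by
        have := h3 j
        simp only [Finsupp.add_apply, ne_eq, reduceCtorEq, not_false_eq_true,
          Finsupp.single_eq_of_ne, add_zero] at this
        simp [pderiv_monomial, this])
      rw [pd_mon] at h5
      exact hcancel _ _ h5
  intro r
  refine up_lemma (σ := Fin m ⊕ Fin m)
    (Sum.elim (fun _ => 0) (fun _ => 1)) (fun a b => ∃ i, a = inl i ∧ b = inr i)
    (by rintro _ _ ⟨i, rfl, rfl⟩; simp)
    (fun r => r.degree = d → monomial r 1 ∈ U) ?_ ?_ _ r (Nat.lt_succ_self _)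
  · intro r h1 h2
    exact hx r h2 (fun i => h1 _ _ ⟨i, rfl, rfl⟩)
  · rintro _ _ ⟨i, rfl, rfl⟩ r h1 h2
    have h5 := hyx i _ (h1 (by simpa using h2))
    rw [pd_mon] at h5
    exact hcancel _ _ h5

/-- For each `n ≥ 1`, the component `L_n = span{X(r) : |r| = n+2}` of the polynomial
Hamiltonian Lie algebra, viewed as a module over `L₀` via the adjoint action, is an
irreducible module: it is nonzero, and every subspace of `L_n` invariant under the
bracket action of `L₀` is `⊥` or all of `L_n`. -/
theorem stmt8 {m : ℕ} (hm : 1 ≤ m) (n : ℕ) (hn : 1 ≤ n) :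
    Lcomp m n ≠ ⊥ ∧
    ∀ W : Submodule ℂ (Derivation ℂ (PolyA m) (PolyA m)),
      W ≤ Lcomp m n →
      (∀ g ∈ Lcomp m 0, ∀ w ∈ W, ⁅g, w⁆ ∈ W) →
      W = ⊥ ∨ W = Lcomp m n := by
  have i₀ : Fin m := ⟨0, hm⟩
  constructor
  · intro hbot
    have h1 : hamD m (monomial (Finsupp.single (inl i₀) (n+2)) 1) ∈ Lcomp m n := by
      rw [Lcomp_eq]
      exact ⟨_, isHomogeneous_monomial _ (by simp), rfl⟩
    rw [hbot, Submodule.mem_bot] at h1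
    have h2 := hamD_inr (monomial (Finsupp.single (inl i₀) (n+2)) 1) i₀
    rw [h1, pderiv_monomial] at h2
    simp only [Derivation.coe_zero, Pi.zero_apply, zero_eq_neg, monomial_eq_zero] at h2
    simp only [Finsupp.single_eq_same, one_mul] at h2
    exact Nat.cast_ne_zero.2 (Nat.succ_ne_zero _) h2
  · intro W hW hinv
    by_cases hb : W = ⊥
    · exact Or.inl hb
    right
    refine le_antisymm hW ?_
    obtain ⟨w, hw, hw0⟩ := (Submodule.ne_bot_iff W).1 hb
    have hw' := hW hw
    rw [Lcomp_eq] at hw'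
    obtain ⟨f, hf, rfl⟩ := hw'
    have key := main_irr i₀ (n+2) (by omega) (W.comap (hamD m)) ?_ f hw
      (by rintro rfl; simp at hw0) hf
    · rw [Lcomp, Submodule.span_le]
      rintro _ ⟨r, hr, rfl⟩
      have := key r (by rw [Finsupp.degree_eq_sum]; exact hr)
      rwa [Submodule.mem_comap, hamD_monomial] at this
    · intro a b g hg
      rw [Submodule.mem_comap, ← hamD_lie]
      refine hinv _ ?_ _ hg
      rw [Lcomp_eq]
      exact ⟨_, (isHomogeneous_X ℂ a).mul (isHomogeneous_X ℂ b), rfl⟩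
end

section
/- Let g be a finite dimensional complex Lie algebra with solvable radical Rad(g). Then [g, Rad(g)] acts trivially on every finite dimensional irreducible g-module. -/
open LieModule LieSubmodule Module Set LieAlgebra in
/-- Let `g` be a finite dimensional complex Lie algebra with solvable radical `Rad(g)`.
Then `[g, Rad(g)]` acts trivially on every finite dimensional irreducible `g`-module. -/
theorem stmt11 {g : Type*} [LieRing g] [LieAlgebra ℂ g] [FiniteDimensional ℂ g]
    (V : Type*) [AddCommGroup V] [Module ℂ V] [LieRingModule g V] [LieModule ℂ g V]
    [FiniteDimensional ℂ V] [LieModule.IsIrreducible ℂ g V] :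
    ∀ x : g, x ∈ ⁅(⊤ : LieIdeal ℂ g), LieAlgebra.radical ℂ g⁆ → ∀ v : V, ⁅x, v⁆ = 0 := by
  have _i := nontrivial_of_isIrreducible ℂ g V
  obtain ⟨χ, hχ⟩ : ∃ χ : Module.Dual ℂ (radical ℂ g), Nontrivial (weightSpace V χ) :=
    exists_nontrivial_weightSpace_of_isSolvable ℂ (radical ℂ g) V
  let N : LieSubmodule ℂ g V := weightSpaceOfIsLieTower ℂ V χ
  replace hχ : Nontrivial N := hχ
  replace hχ : N = ⊤ := N.eq_top_of_isIrreducible ℂ g V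
  have key (m : V) : ∀ (y : g) (hy : y ∈ radical ℂ g), ⁅y, m⁆ = χ ⟨y, hy⟩ • m := by
    simpa [N, weightSpaceOfIsLieTower, mem_weightSpace] using (hχ ▸ mem_top _ : m ∈ N)
  have hle : ⁅(⊤ : LieIdeal ℂ g), radical ℂ g⁆ ≤ LieModule.ker ℂ g V := by
    rw [LieSubmodule.lie_le_iff]
    intro y _ x hx
    rw [LieModule.mem_ker]
    intro m
    rw [lie_lie, key _ x hx, key _ x hx, lie_smul, sub_self]
  intro x hx v
  have h := hle hx
  exact (LieModule.mem_ker ℂ g V x).mp h v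
end
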